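/- Let m ≥ 1, 1 < θ < 2, and let f : ℝ^m → ℝ satisfy (H0) and (H1) with parameters α, f₀ > 0, and set γ = α/θ + 1. If (λ₁, φ) and (λ₂, ψ) are two solutions of the ergodic problem (EP) with φ, ψ ∈ Φ_γ, then λ₁ = λ₂ and there exists a constant C ∈ ℝ with φ = ψ + C. -/

import Mathlib

open Filter

noncomputable def lap {m : ℕ} (φ : EuclideanSpace ℝ (Fin m) → ℝ)
    (y : EuclideanSpace ℝ (Fin m)) : ℝ :=
  ∑ i : Fin m, iteratedFDeriv ℝ 2 φ y ![EuclideanSpace.single i 1, EuclideanSpace.single i 1]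

def IsSubsolution {m : ℕ} (θ : ℝ) (f : EuclideanSpace ℝ (Fin m) → ℝ) (lam : ℝ)
    (φ : EuclideanSpace ℝ (Fin m) → ℝ) : Prop :=
  ContDiff ℝ 2 φ ∧
    ∀ y, -(1/2) * lap φ y + (1/θ) * ‖gradient φ y‖ ^ θ ≤ f y - lam

def IsSupersolution {m : ℕ} (θ : ℝ) (f : EuclideanSpace ℝ (Fin m) → ℝ) (lam : ℝ)
    (φ : EuclideanSpace ℝ (Fin m) → ℝ) : Prop :=
  ContDiff ℝ 2 φ ∧
    ∀ y, -(1/2) * lap φ y + (1/θ) * ‖gradient φ y‖ ^ θ ≥ f y - lam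

def IsSolution {m : ℕ} (θ : ℝ) (f : EuclideanSpace ℝ (Fin m) → ℝ) (lam : ℝ)
    (φ : EuclideanSpace ℝ (Fin m) → ℝ) : Prop :=
  ContDiff ℝ 2 φ ∧
    ∀ y, -(1/2) * lap φ y + (1/θ) * ‖gradient φ y‖ ^ θ = f y - lam

noncomputable def lambdaStar {m : ℕ} (θ : ℝ) (f : EuclideanSpace ℝ (Fin m) → ℝ) : ℝ :=
  sSup {lam : ℝ | ∃ φ, IsSubsolution θ f lam φ}

def H0 {m : ℕ} (f : EuclideanSpace ℝ (Fin m) → ℝ) (α f₀ : ℝ) : Prop :=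
  LocallyLipschitz f ∧ BddBelow (Set.range f) ∧
    ∀ y, DifferentiableAt ℝ f y →
      (1 ≤ α → ‖gradient f y‖ ≤ f₀ * (1 + ‖y‖ ^ (α - 1))) ∧
      (α < 1 → ‖gradient f y‖ ≤ f₀)

def H1 {m : ℕ} (f : EuclideanSpace ℝ (Fin m) → ℝ) (α f₀ : ℝ) : Prop :=
  ∀ y, f₀⁻¹ * (‖y‖ ^ α + 1) ≤ f y ∧ f y ≤ f₀ * (‖y‖ ^ α + 1)

def MemPhi {m : ℕ} (γ : ℝ) (v : EuclideanSpace ℝ (Fin m) → ℝ) : Prop :=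
  ContDiff ℝ 2 v ∧ ∃ c > 1, ∀ y, c⁻¹ * ‖y‖ ^ γ - c ≤ v y ∧ v y ≤ c * (1 + ‖y‖ ^ γ)

def Coercive {m : ℕ} (f : EuclideanSpace ℝ (Fin m) → ℝ) : Prop :=
  Tendsto f (cocompact (EuclideanSpace ℝ (Fin m))) atTop



theorem lap_eq {m : ℕ} (u : EuclideanSpace ℝ (Fin m) → ℝ) (y : EuclideanSpace ℝ (Fin m)) :
    lap u y = ∑ i : Fin m, fderiv ℝ (fderiv ℝ u) y (EuclideanSpace.single i 1)
      (EuclideanSpace.single i 1) := by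
  simp [lap, iteratedFDeriv_two_apply]

theorem dd {m : ℕ} {u : EuclideanSpace ℝ (Fin m) → ℝ} (hu : ContDiff ℝ 2 u) :
    Differentiable ℝ u ∧ Differentiable ℝ (fderiv ℝ u) := by
  refine ⟨hu.differentiable (by norm_num), ?_⟩
  exact (hu.fderiv_right (m := 1) (by norm_num)).differentiable (by norm_num)

theorem lap_comb {m : ℕ} {u v w : EuclideanSpace ℝ (Fin m) → ℝ} (hu : ContDiff ℝ 2 u)
    (hv : ContDiff ℝ 2 v) (hw : ContDiff ℝ 2 w) (a b c : ℝ) (y : EuclideanSpace ℝ (Fin m)) :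
    lap (fun y => a * u y + b * v y + c * w y) y = a * lap u y + b * lap v y + c * lap w y := by
  obtain ⟨u1, u2⟩ := dd hu
  obtain ⟨v1, v2⟩ := dd hv
  obtain ⟨w1, w2⟩ := dd hw
  have h1 : fderiv ℝ (fun y => a * u y + b * v y + c * w y)
      = fun y => a • fderiv ℝ u y + b • fderiv ℝ v y + c • fderiv ℝ w y := by
    funext y
    exact ((((u1 y).hasFDerivAt.const_mul a).add ((v1 y).hasFDerivAt.const_mul b)).add
      ((w1 y).hasFDerivAt.const_mul c)).fderiv
  have h2 : fderiv ℝ (fun y => a • fderiv ℝ u y + b • fderiv ℝ v y + c • fderiv ℝ w y) y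
      = a • fderiv ℝ (fderiv ℝ u) y + b • fderiv ℝ (fderiv ℝ v) y
        + c • fderiv ℝ (fderiv ℝ w) y := by
    exact ((((u2 y).hasFDerivAt.const_smul a).add ((v2 y).hasFDerivAt.const_smul b)).add
      ((w2 y).hasFDerivAt.const_smul c)).fderiv
  simp only [lap_eq, h1, h2, Finset.mul_sum, ← Finset.sum_add_distrib]
  simp

theorem grad_comb {m : ℕ} {u v w : EuclideanSpace ℝ (Fin m) → ℝ} (hu : ContDiff ℝ 2 u)
    (hv : ContDiff ℝ 2 v) (hw : ContDiff ℝ 2 w) (a b c : ℝ) (y : EuclideanSpace ℝ (Fin m)) :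
    gradient (fun y => a * u y + b * v y + c * w y) y
      = a • gradient u y + b • gradient v y + c • gradient w y := by
  obtain ⟨u1, u2⟩ := dd hu
  obtain ⟨v1, v2⟩ := dd hv
  obtain ⟨w1, w2⟩ := dd hw
  have h1 : fderiv ℝ (fun y => a * u y + b * v y + c * w y) y
      = a • fderiv ℝ u y + b • fderiv ℝ v y + c • fderiv ℝ w y := by
    exact ((((u1 y).hasFDerivAt.const_mul a).add ((v1 y).hasFDerivAt.const_mul b)).add
      ((w1 y).hasFDerivAt.const_mul c)).fderiv
  simp only [gradient, h1, map_add]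
  simp

theorem max_test {m : ℕ} {u : EuclideanSpace ℝ (Fin m) → ℝ} (hu : ContDiff ℝ 2 u)
    {y : EuclideanSpace ℝ (Fin m)} (hy : IsLocalMax u y) :
    gradient u y = 0 ∧ lap u y ≤ 0 := by
  obtain ⟨u1, u2⟩ := dd hu
  have h0 := hy.fderiv_eq_zero
  refine ⟨by simp [gradient, h0], ?_⟩
  rw [lap_eq]
  apply Finset.sum_nonpos
  intro i _
  set e : EuclideanSpace ℝ (Fin m) := EuclideanSpace.single i 1
  by_contra! hpos
  let L : ℝ → EuclideanSpace ℝ (Fin m) := fun t => y + t • e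
  have hL : ∀ t, HasDerivAt L e t := by
    intro t
    have := ((hasDerivAt_id t).smul_const e).const_add y
    rw [one_smul] at this
    exact this
  have hL0 : L 0 = y := by simp [L]
  have d1 : deriv (fun t => u (L t)) = fun t => fderiv ℝ u (L t) e := by
    funext t
    exact ((u1 (L t)).hasFDerivAt.comp_hasDerivAt t (hL t)).deriv
  have d2 : deriv (fun t => fderiv ℝ u (L t) e) 0 = fderiv ℝ (fderiv ℝ u) y e e := by
    have := ((u2 (L 0)).hasFDerivAt.comp_hasDerivAt 0 (hL 0)).clm_apply (hasDerivAt_const (0:ℝ) e)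
    rw [hL0] at this
    simpa using this.deriv
  have hcont : Continuous L := by fun_prop
  have hmin : IsLocalMin (fun t => u (L t)) 0 := by
    apply isLocalMin_of_deriv_deriv_pos
    · rw [d1, d2]; exact hpos
    · rw [d1]; simp [hL0, h0]
    · exact (u1.continuous.comp hcont).continuousAt
  have hmax : IsLocalMax (fun t => u (L t)) 0 := by
    have : Tendsto L (nhds 0) (nhds y) := by
      have := hcont.tendsto 0
      rwa [hL0] at this
    have h := this.eventually hy
    simpa [IsLocalMax, IsMaxFilter, hL0] using h
  have hconst : (fun t => u (L t)) =ᶠ[nhds 0] fun _ => u (L 0) := by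
    filter_upwards [hmin, hmax] with t a b
    exact le_antisymm b a
  have := hconst.deriv.deriv_eq
  rw [d1, d2] at this
  simp at this
  linarith

theorem radial {m : ℕ} (x : EuclideanSpace ℝ (Fin m)) (H H1 H2 : ℝ → ℝ)
    (hH : ∀ t, 0 ≤ t → HasDerivAt H (H1 t) t) (hH1 : ∀ t, 0 ≤ t → HasDerivAt H1 (H2 t) t)
    (y : EuclideanSpace ℝ (Fin m)) :
    gradient (fun y => H (‖y - x‖ ^ 2)) y = (2 * H1 (‖y - x‖ ^ 2)) • (y - x) ∧
    lap (fun y => H (‖y - x‖ ^ 2)) y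
      = 4 * ‖y - x‖ ^ 2 * H2 (‖y - x‖ ^ 2) + 2 * m * H1 (‖y - x‖ ^ 2) := by
  obtain ⟨IL, hIL⟩ : ∃ IL : EuclideanSpace ℝ (Fin m) →L[ℝ] EuclideanSpace ℝ (Fin m) →L[ℝ] ℝ,
      ∀ a b, IL a b = inner ℝ a b := ⟨innerSL ℝ, fun a b => rfl⟩
  have hn : ∀ y : EuclideanSpace ℝ (Fin m),
      HasFDerivAt (fun y => ‖y - x‖ ^ 2) (2 • (IL (y - x))) y := by
    intro y
    have := ((hasFDerivAt_id y).sub_const x).norm_sq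
    have e : (2:ℕ) • (IL (y - x)) = 2 • (innerSL ℝ (y - x)) := by
      ext z; simp [hIL]
    rw [e]
    simpa using this
  have h1 : ∀ y, HasFDerivAt (fun y => H (‖y - x‖ ^ 2))
      ((H1 (‖y - x‖ ^ 2)) • (2 • (IL (y - x)))) y := by
    intro y
    exact (hH _ (by positivity)).comp_hasFDerivAt y (hn y)
  have h1' : fderiv ℝ (fun y => H (‖y - x‖ ^ 2)) = fun y =>
      (H1 (‖y - x‖ ^ 2)) • (2 • (IL (y - x))) := by
    funext y; exact (h1 y).fderiv
  constructor
  · rw [gradient, h1']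
    rw [LinearIsometryEquiv.symm_apply_eq]
    ext z
    simp [hIL]
    ring
  · have hin : HasFDerivAt (fun y => (2:ℕ) • (IL (y - x))) ((2:ℕ) • IL) y :=
      ((IL.hasFDerivAt (x := y - x)).comp y ((hasFDerivAt_id y).sub_const x)).const_smul 2
    have h2 := ((hH1 (‖y - x‖ ^ 2) (by positivity)).comp_hasFDerivAt y (hn y)).smul hin
    have h3 : fderiv ℝ (fun y => (H1 (‖y - x‖ ^ 2)) • ((2:ℕ) • (IL (y - x)))) y
        = H1 (‖y - x‖ ^ 2) • ((2:ℕ) • IL) +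
          (H2 (‖y - x‖ ^ 2) • (2:ℕ) • (IL (y - x))).smulRight
            ((2:ℕ) • (IL (y - x))) := h2.fderiv
    rw [lap_eq, h1', h3]
    generalize H1 (‖y - x‖ ^ 2) = A
    generalize H2 (‖y - x‖ ^ 2) = B
    have hs : ‖y - x‖ ^ 2 = ∑ i, (y i - x i) ^ 2 := by
      simp [EuclideanSpace.norm_sq_eq]
    rw [hs, Finset.mul_sum, Finset.sum_mul]
    have key : ∀ i : Fin m, ((A • ((2:ℕ) • IL) +
          (B • (2:ℕ) • (IL (y - x))).smulRight ((2:ℕ) • (IL (y - x))) :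
          EuclideanSpace ℝ (Fin m) →L[ℝ] EuclideanSpace ℝ (Fin m) →L[ℝ] ℝ)
          (EuclideanSpace.single i 1)) (EuclideanSpace.single i 1)
          = 4 * (y i - x i) ^ 2 * B + 2 * A := by
      intro i
      have e1 : (IL (EuclideanSpace.single i (1:ℝ))) (EuclideanSpace.single i (1:ℝ)) = 1 := by
        rw [hIL]; simp
      have e2 : (IL (y - x)) (EuclideanSpace.single i (1:ℝ)) = y i - x i := by
        rw [hIL]; simp [EuclideanSpace.inner_single_right]
      have : ∀ a b : ℝ, a = 1 → b = y i - x i →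
        A * ((2:ℕ) • a) + (B * ((2:ℕ) • b)) * ((2:ℕ) • b) = 4 * (y i - x i) ^ 2 * B + 2 * A := by
        rintro _ _ rfl rfl; simp; ring
      exact this _ _ e1 e2
    refine (Finset.sum_congr rfl fun i _ => key i).trans ?_
    rw [Finset.sum_add_distrib]
    simp
    ring

theorem conv_ineq {m : ℕ} {θ δ : ℝ} (hθ : 1 < θ) (h0 : 0 < δ) (h1 : δ < 1)
    (p q : EuclideanSpace ℝ (Fin m)) :
    ‖δ • p + q‖ ^ θ ≤ δ * ‖p‖ ^ θ + (1 - δ) ^ (1 - θ) * ‖q‖ ^ θ := by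
  have hd : 0 < 1 - δ := by linarith
  have hc := (convexOn_rpow hθ.le).2 (x := ‖p‖) (by simp) (y := ‖q‖ / (1 - δ))
    (by simp; positivity) h0.le hd.le (by ring)
  simp only [smul_eq_mul] at hc
  have e1 : δ * ‖p‖ + (1 - δ) * (‖q‖ / (1 - δ)) = δ * ‖p‖ + ‖q‖ := by
    field_simp
  rw [e1, Real.div_rpow (norm_nonneg _) hd.le] at hc
  have e2 : (1 - δ) * (‖q‖ ^ θ / (1 - δ) ^ θ) = (1 - δ) ^ (1 - θ) * ‖q‖ ^ θ := by
    rw [Real.rpow_sub hd, Real.rpow_one]; ring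
  rw [e2] at hc
  refine le_trans ?_ hc
  apply Real.rpow_le_rpow (norm_nonneg _) _ (by linarith)
  refine (norm_add_le _ _).trans ?_
  rw [norm_smul, Real.norm_of_nonneg h0.le]

theorem max_ineq {m : ℕ} {θ δ : ℝ} (hθ : 1 < θ) (h0 : 0 < δ) (h1 : δ < 1)
    {f φ ψ χ : EuclideanSpace ℝ (Fin m) → ℝ} {l1 l2 : ℝ}
    (hφ : IsSolution θ f l1 φ) (hψ : IsSolution θ f l2 ψ) (hχ : ContDiff ℝ 2 χ)
    {y : EuclideanSpace ℝ (Fin m)}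
    (hy : IsLocalMax (fun y => δ * ψ y + (-1) * φ y + (-1) * χ y) y) :
    (1 - δ) * f y ≤ l1 - δ * l2 + 1 / 2 * lap χ y
      + 1 / θ * ((1 - δ) ^ (1 - θ) * ‖gradient χ y‖ ^ θ) := by
  have hc : ContDiff ℝ 2 (fun y => δ * ψ y + (-1) * φ y + (-1) * χ y) :=
    ((contDiff_const.mul hψ.1).add (contDiff_const.mul hφ.1)).add (contDiff_const.mul hχ)
  obtain ⟨g, l⟩ := max_test hc hy
  rw [grad_comb hψ.1 hφ.1 hχ] at g
  rw [lap_comb hψ.1 hφ.1 hχ] at l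
  have e1 := hφ.2 y
  have e2 := hψ.2 y
  have g' : gradient φ y = δ • gradient ψ y + (-gradient χ y) := by
    have : gradient φ y = (δ • gradient ψ y + (-1:ℝ) • gradient φ y + (-1:ℝ) • gradient χ y)
      + gradient φ y + gradient χ y - gradient χ y := by rw [g]; abel
    rw [this]; module
  have hcv := conv_ineq hθ h0 h1 (gradient ψ y) (-gradient χ y)
  rw [← g', norm_neg] at hcv
  have hcv2 := mul_le_mul_of_nonneg_left hcv (show 0 ≤ 1 / θ by positivity)
  rw [mul_add] at hcv2
  have e3 : δ * (-(1/2) * lap ψ y) + 1 / θ * (δ * ‖gradient ψ y‖ ^ θ) = δ * (f y - l2) := by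
    rw [← e2]; ring
  linarith

theorem pen {m : ℕ} {γ ε R : ℝ} (hγ : 1 < γ) (hε : 0 < ε) (hε1 : ε ≤ 1) (hR : 0 < R)
    (χ : EuclideanSpace ℝ (Fin m) → ℝ)
    (hχ : χ = fun y => ε * (((1 + ‖y‖ ^ 2) ^ (γ / 2)) ^ 2 / ((1 + ‖y‖ ^ 2) ^ (γ / 2) + R))) :
    ContDiff ℝ 2 χ ∧ ∀ y, ‖gradient χ y‖ ≤ ε * γ * (1 + ‖y‖ ^ 2) ^ ((γ - 1) / 2) ∧
      lap χ y ≤ (3 * γ ^ 2 + m * γ) * (1 + ‖y‖ ^ 2) ^ ((γ - 1) / 2) := by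
  constructor
  · rw [hχ]
    have h1 : ContDiff ℝ 2 (fun y : EuclideanSpace ℝ (Fin m) => (1 + ‖y‖ ^ 2) ^ (γ / 2)) := by
      apply ContDiff.rpow_const_of_ne
      · exact contDiff_const.add (contDiff_norm_sq ℝ)
      · intro y; positivity
    refine contDiff_const.mul ((h1.pow 2).div (h1.add contDiff_const) ?_)
    intro y; positivity
  intro y
  let s : ℝ → ℝ := fun t => (1 + t) ^ (γ / 2)
  let s1 : ℝ → ℝ := fun t => (γ / 2) * (1 + t) ^ (γ / 2 - 1)
  let s2 : ℝ → ℝ := fun t => (γ / 2) * ((γ / 2 - 1) * (1 + t) ^ (γ / 2 - 2))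
  have hs : ∀ t, 0 ≤ t → HasDerivAt s (s1 t) t := by
    intro t ht
    have := ((hasDerivAt_id t).const_add 1).rpow_const (p := γ / 2)
      (Or.inl (by simp only [id]; positivity))
    simpa [s, s1] using this
  have hs1 : ∀ t, 0 ≤ t → HasDerivAt s1 (s2 t) t := by
    intro t ht
    have := (((hasDerivAt_id t).const_add 1).rpow_const (p := γ / 2 - 1)
      (Or.inl (by simp only [id]; positivity))).const_mul (γ / 2)
    refine HasDerivAt.congr_deriv (f := s1) this ?_
    have e : γ / 2 - 1 - 1 = γ / 2 - 2 := by ring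
    rw [e]
    simp only [s2, id, one_mul]
  have hb : ∀ u : ℝ, 0 < u → HasDerivAt (fun u => u ^ 2 / (u + R))
      ((u ^ 2 + 2 * u * R) / (u + R) ^ 2) u := by
    intro u hu
    have := ((hasDerivAt_id u).pow 2).div ((hasDerivAt_id u).add_const R)
      (by simp only [id]; positivity)
    refine HasDerivAt.congr_deriv (f := fun u => u ^ 2 / (u + R)) this ?_
    simp only [id, Pi.pow_apply]
    congr 1
    push_cast
    ring
  have hb1 : ∀ u : ℝ, 0 < u → HasDerivAt (fun u => (u ^ 2 + 2 * u * R) / (u + R) ^ 2)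
      (2 * R ^ 2 / (u + R) ^ 3) u := by
    intro u hu
    have h1 : HasDerivAt (fun u : ℝ => u ^ 2 + 2 * u * R) (2 * u + 2 * R) u := by
      have := ((hasDerivAt_id u).pow 2).add (((hasDerivAt_id u).const_mul 2).mul_const R)
      refine HasDerivAt.congr_deriv (f := fun u : ℝ => u ^ 2 + 2 * u * R) this ?_
      simp
    have h2 : HasDerivAt (fun u : ℝ => (u + R) ^ 2) (2 * (u + R)) u := by
      have := ((hasDerivAt_id u).add_const R).pow 2
      refine HasDerivAt.congr_deriv (f := fun u : ℝ => (u + R) ^ 2) this ?_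
      simp
    have := h1.div h2 (by positivity)
    refine HasDerivAt.congr_deriv (f := fun u => (u ^ 2 + 2 * u * R) / (u + R) ^ 2) this ?_
    field_simp
    ring
  have hspos : ∀ t, 0 ≤ t → 0 < s t := fun t ht => by simp only [s]; positivity
  let H : ℝ → ℝ := fun t => ε * ((s t) ^ 2 / (s t + R))
  let H1 : ℝ → ℝ := fun t => ε * ((((s t) ^ 2 + 2 * (s t) * R) / (s t + R) ^ 2) * s1 t)
  let H2 : ℝ → ℝ := fun t => ε * ((2 * R ^ 2 / (s t + R) ^ 3 * s1 t) * s1 t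
    + (((s t) ^ 2 + 2 * (s t) * R) / (s t + R) ^ 2) * s2 t)
  have hH : ∀ t, 0 ≤ t → HasDerivAt H (H1 t) t := fun t ht =>
    ((hb _ (hspos t ht)).comp t (hs t ht)).const_mul ε
  have hH1 : ∀ t, 0 ≤ t → HasDerivAt H1 (H2 t) t := fun t ht =>
    (((hb1 _ (hspos t ht)).comp t (hs t ht)).mul (hs1 t ht)).const_mul ε
  obtain ⟨hg, hl⟩ := radial 0 H H1 H2 hH hH1 y
  simp only [sub_zero] at hg hl
  have hHχ : (fun y : EuclideanSpace ℝ (Fin m) => H (‖y‖ ^ 2)) = χ := by rw [hχ]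
  rw [hHχ] at hg hl
  rw [hg, hl]
  set t := ‖y‖ ^ 2 with ht
  have ht0 : 0 ≤ t := by positivity
  have hT : 1 ≤ 1 + t := by linarith
  have hTp : 0 < 1 + t := by linarith
  have hsp := hspos t ht0
  have b1 : ((s t) ^ 2 + 2 * (s t) * R) / (s t + R) ^ 2 ≤ 1 := by
    rw [div_le_one (by positivity)]; nlinarith
  have b0 : 0 ≤ ((s t) ^ 2 + 2 * (s t) * R) / (s t + R) ^ 2 := by positivity
  have b2 : 2 * R ^ 2 / (s t + R) ^ 3 ≤ 2 / s t := by
    rw [div_le_div_iff₀ (by positivity) hsp]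
    have : 0 ≤ s t ^ 3 + 3 * s t ^ 2 * R + 2 * s t * R ^ 2 + R ^ 3 := by positivity
    nlinarith
  have hs1p : 0 ≤ s1 t := by simp only [s1]; positivity
  have hH1p : 0 ≤ H1 t := by simp only [H1]; positivity
  have hH1le : H1 t ≤ ε * s1 t := by
    simp only [H1]
    apply mul_le_mul_of_nonneg_left _ hε.le
    nlinarith
  have hy : ‖y‖ ≤ (1 + t) ^ (1 / 2 : ℝ) := by
    rw [← Real.sqrt_eq_rpow]
    apply Real.le_sqrt_of_sq_le
    linarith
  set W := (1 + t) ^ (γ / 2 - 2) with hW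
  have hWp : 0 ≤ W := by positivity
  have w1 : (1 + t) ^ (γ / 2 - 1) = W * (1 + t) := by
    rw [hW, ← Real.rpow_add_one hTp.ne']; congr 1; ring
  have w2 : s t = W * (1 + t) ^ 2 := by
    simp only [s]
    rw [hW, ← Real.rpow_natCast, ← Real.rpow_add hTp]; congr 1; push_cast; ring
  have w3 : W * (1 + t) ≤ (1 + t) ^ ((γ - 1) / 2) := by
    rw [← w1]; apply Real.rpow_le_rpow_of_exponent_le hT; linarith
  constructor
  · rw [norm_smul, Real.norm_of_nonneg (by positivity)]
    have e : (1 + t) ^ ((γ - 1) / 2) = (1 + t) ^ (γ / 2 - 1) * (1 + t) ^ (1 / 2 : ℝ) := by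
      rw [← Real.rpow_add hTp]; congr 1; ring
    calc 2 * H1 t * ‖y‖ ≤ 2 * (ε * s1 t) * (1 + t) ^ (1 / 2 : ℝ) := by gcongr
      _ = _ := by rw [e]; simp only [s1]; ring
  · have hWpos : 0 < W := by positivity
    have a1 : 2 / s t * s1 t * s1 t = γ ^ 2 / 2 * W := by
      simp only [s1]; rw [w1, w2]; field_simp
    have a2 : (((s t) ^ 2 + 2 * (s t) * R) / (s t + R) ^ 2) * s2 t ≤ γ ^ 2 / 4 * W := by
      have : s2 t ≤ γ ^ 2 / 4 * W := by
        have : s2 t = γ ^ 2 / 4 * W - γ / 2 * W := by simp only [s2]; ring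
        rw [this]; have : 0 ≤ γ / 2 * W := by positivity
        linarith
      calc _ ≤ (((s t) ^ 2 + 2 * (s t) * R) / (s t + R) ^ 2) * (γ ^ 2 / 4 * W) := by gcongr
        _ ≤ 1 * (γ ^ 2 / 4 * W) := by gcongr
        _ = _ := one_mul _
    have a3 : (2 * R ^ 2 / (s t + R) ^ 3 * s1 t) * s1 t ≤ γ ^ 2 / 2 * W := by
      rw [← a1]; gcongr
    have a4 : H2 t ≤ 3 * γ ^ 2 / 4 * W := by
      have h : H2 t ≤ ε * (3 * γ ^ 2 / 4 * W) := by
        simp only [H2]; apply mul_le_mul_of_nonneg_left _ hε.le; linarith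
      have : 0 ≤ 3 * γ ^ 2 / 4 * W := by positivity
      nlinarith
    have a5 : H1 t ≤ γ / 2 * (W * (1 + t)) := by
      have e : s1 t = γ / 2 * (W * (1 + t)) := by simp only [s1]; rw [w1]
      rw [← e]; nlinarith
    have a6 : 4 * t * H2 t ≤ 3 * γ ^ 2 * (W * (1 + t)) := by
      have h1 : 4 * t * H2 t ≤ 4 * t * (3 * γ ^ 2 / 4 * W) := by gcongr
      have h2 : 0 ≤ 3 * γ ^ 2 * W := by positivity
      linarith
    have a7 : 2 * (m:ℝ) * H1 t ≤ m * γ * (W * (1 + t)) := by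
      have h1 : 2 * (m:ℝ) * H1 t ≤ 2 * m * (γ / 2 * (W * (1 + t))) := by gcongr
      linarith
    have a8 : (3 * γ ^ 2 + m * γ) * (W * (1 + t))
      ≤ (3 * γ ^ 2 + m * γ) * (1 + t) ^ ((γ - 1) / 2) := by gcongr
    linarith

set_option maxHeartbeats 1000000 in
theorem smp {m : ℕ} {θ l : ℝ} (hθ : 1 < θ)
    {f φ ψ : EuclideanSpace ℝ (Fin m) → ℝ}
    (hφ : IsSolution θ f l φ) (hψ : IsSolution θ f l ψ) (y0 : EuclideanSpace ℝ (Fin m))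
    (hmax : ∀ y, ψ y - φ y ≤ ψ y0 - φ y0) : ∀ y, ψ y - φ y = ψ y0 - φ y0 := by
  by_contra! hne
  obtain ⟨x1, hx1⟩ := hne
  set M := ψ y0 - φ y0 with hM
  have cφ := hφ.1.continuous
  have cψ := hψ.1.continuous
  have hZc : IsClosed {y | ψ y - φ y = M} := isClosed_eq (by fun_prop) continuous_const
  obtain ⟨z, hzZ, hz⟩ := hZc.exists_infDist_eq_dist ⟨y0, rfl⟩ x1
  have hzZ' : ψ z - φ z = M := hzZ
  have hfar : ∀ y, ψ y - φ y = M → dist x1 z ≤ dist x1 y := by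
    intro y hy
    rw [← hz]
    exact Metric.infDist_le_dist_of_mem hy
  have hx1z : 0 < dist x1 z := by
    rw [dist_pos]; rintro rfl; exact hx1 hzZ'
  set x : EuclideanSpace ℝ (Fin m) := (1/2:ℝ) • (x1 + z) with hx
  set ρ := ‖z - x‖ with hρ
  have hxx : z - x = x - x1 := by rw [hx]; module
  have hd : dist x1 z = 2 * ρ := by
    have : x1 - z = (-2:ℝ) • (z - x) := by rw [hx]; module
    rw [dist_eq_norm, this, norm_smul]; norm_num [hρ]
  have hρ0 : 0 < ρ := by linarith
  have honly : ∀ y, ‖y - x‖ ≤ ρ → ψ y - φ y = M → y = z := by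
    intro y hy hyM
    have h1 := hfar y hyM
    rw [hd, dist_comm, dist_eq_norm] at h1
    have e1 : y - x1 = (y - x) + (z - x) := by rw [hxx]; abel
    rw [e1] at h1
    have hp := parallelogram_law_with_norm ℝ (y - x) (z - x)
    have e2 : y - x - (z - x) = y - z := by abel
    rw [e2] at hp
    have h3 : ‖y - z‖ * ‖y - z‖ ≤ 0 := by
      have := norm_nonneg (y - x)
      nlinarith
    have h4 : ‖y - z‖ = 0 := by nlinarith [norm_nonneg (y - z)]
    rwa [norm_sub_eq_zero_iff] at h4
  have hgc : ∀ {u : EuclideanSpace ℝ (Fin m) → ℝ}, ContDiff ℝ 2 u →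
      Continuous (fun y => ‖gradient u y‖) := by
    intro u hu
    have : (fun y => ‖gradient u y‖) = fun y => ‖fderiv ℝ u y‖ := by
      funext y; simp [gradient]
    rw [this]
    exact (dd hu).2.continuous.norm
  obtain ⟨G, hG⟩ : ∃ G, ∀ y ∈ Metric.closedBall z (ρ / 2),
      ‖gradient ψ y‖ + ‖gradient φ y‖ ≤ G := by
    obtain ⟨G, hG⟩ := (isCompact_closedBall z (ρ / 2)).bddAbove_image
      (((hgc hψ.1).add (hgc hφ.1)).continuousOn)
    exact ⟨G, fun y hy => hG ⟨y, hy, rfl⟩⟩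
  have hG0 : 0 ≤ G := le_trans (by positivity) (hG z (by simp; positivity))
  set L := G ^ (θ - 1) with hL
  have hL0 : 0 ≤ L := by positivity
  have hlip : ∀ a b : ℝ, 0 ≤ a → a ≤ G → 0 ≤ b → b ≤ G →
      1 / θ * b ^ θ - 1 / θ * a ^ θ ≤ L * |b - a| := by
    intro a b ha haG hb hbG
    have := (convex_Icc (0:ℝ) G).norm_image_sub_le_of_norm_hasDerivWithin_le
      (f := fun t => 1 / θ * t ^ θ) (f' := fun t => t ^ (θ - 1)) (C := L) (x := a) (y := b)
      (fun t ht => by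
        have h := ((Real.hasDerivAt_rpow_const (x := t) (p := θ) (Or.inr hθ.le)).const_mul (1 / θ))
        have e : 1 / θ * (θ * t ^ (θ - 1)) = t ^ (θ - 1) := by field_simp
        rw [e] at h
        exact h.hasDerivWithinAt)
      (fun t ht => by
        rw [Real.norm_of_nonneg (Real.rpow_nonneg ht.1 _)]
        exact Real.rpow_le_rpow ht.1 ht.2 (by linarith)) ⟨ha, haG⟩ ⟨hb, hbG⟩
    simp only [Real.norm_eq_abs] at this
    exact (le_abs_self _).trans this
  set k := (m + 4 * L * ρ + 1) * 2 / ρ ^ 2 with hk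
  have hk0 : 0 < k := by positivity
  let v : EuclideanSpace ℝ (Fin m) → ℝ := fun y => Real.exp (-k * ‖y - x‖ ^ 2)
  have hvc : ContDiff ℝ 2 v := by
    apply ContDiff.exp
    exact contDiff_const.mul ((contDiff_id.sub contDiff_const).norm_sq ℝ)
  have hv : ∀ y, ‖gradient v y‖ = 2 * k * ‖y - x‖ * v y ∧
      lap v y = (4 * k ^ 2 * ‖y - x‖ ^ 2 - 2 * m * k) * v y := by
    intro y
    obtain ⟨a, b⟩ := radial x (fun t => Real.exp (-k * t)) (fun t => -k * Real.exp (-k * t))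
      (fun t => k ^ 2 * Real.exp (-k * t))
      (fun t _ => by
        have := ((hasDerivAt_id' t).const_mul (-k)).exp
        exact this.congr_deriv (by ring))
      (fun t _ => by
        have := (((hasDerivAt_id' t).const_mul (-k)).exp).const_mul (-k)
        exact this.congr_deriv (by ring)) y
    constructor
    · have a' : gradient v y = (2 * (-k * v y)) • (y - x) := a
      rw [a', norm_smul, Real.norm_eq_abs]
      have : |2 * (-k * v y)| = 2 * k * v y := by
        have h : 2 * (-k * v y) = -(2 * k * v y) := by ring
        rw [h, abs_neg, abs_of_nonneg]
        have := Real.exp_pos (-k * ‖y - x‖ ^ 2)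
        positivity
      rw [this]; ring
    · have b' : lap v y = 4 * ‖y - x‖ ^ 2 * (k ^ 2 * v y) + 2 * m * (-k * v y) := b
      rw [b']; ring
  have hvpos : ∀ y, 0 < v y := fun y => Real.exp_pos _
  have hv1 : ∀ y, v y ≤ 1 := fun y => by
    apply Real.exp_le_one_iff.2
    have : 0 ≤ k * ‖y - x‖ ^ 2 := by positivity
    linarith
  have hvz : ∀ y, ρ < ‖y - x‖ → v y < v z := fun y hy => by
    apply Real.exp_lt_exp.2
    have : ρ ^ 2 < ‖y - x‖ ^ 2 := by gcongr
    change -k * ‖y - x‖ ^ 2 < -k * ρ ^ 2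
    nlinarith
  obtain ⟨c, hc0, hc⟩ : ∃ c > 0, ∀ y ∈ Metric.sphere z (ρ / 2) ∩ Metric.closedBall x ρ,
      ψ y - φ y ≤ M - c := by
    have hK : IsCompact (Metric.sphere z (ρ / 2) ∩ Metric.closedBall x ρ) :=
      (isCompact_sphere z (ρ / 2)).inter_right Metric.isClosed_closedBall
    rcases (Metric.sphere z (ρ / 2) ∩ Metric.closedBall x ρ).eq_empty_or_nonempty with h | h
    · exact ⟨1, one_pos, fun y hy => by rw [h] at hy; exact hy.elim⟩
    · obtain ⟨p, hp, hpm⟩ := hK.exists_isMaxOn h (f := fun y => ψ y - φ y)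
        (by fun_prop)
      refine ⟨M - (ψ p - φ p), ?_, fun y hy => ?_⟩
      · have h1 : ψ p - φ p ≠ M := by
          intro h2
          have h3 := honly p (by simpa [dist_eq_norm] using hp.2) h2
          have h4 : dist p z = ρ / 2 := hp.1
          rw [h3, dist_self] at h4
          linarith
        have := lt_of_le_of_ne (hmax p) h1
        linarith
      · have : ψ y - φ y ≤ ψ p - φ p := hpm hy
        linarith
  set ε := c / 2 with hε
  have hε0 : 0 < ε := by positivity
  have cv := hvc.continuous
  obtain ⟨y, hy, hym⟩ := (isCompact_closedBall z (ρ / 2)).exists_isMaxOn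
    ⟨z, by simp; positivity⟩ (f := fun y => 1 * ψ y + (-1) * φ y + ε * v y) (by fun_prop)
  have hyz : 1 * ψ z + (-1) * φ z + ε * v z ≤ 1 * ψ y + (-1) * φ y + ε * v y :=
    hym (by simp; positivity : z ∈ Metric.closedBall z (ρ / 2))
  have hyball : y ∈ Metric.ball z (ρ / 2) := by
    rw [Metric.mem_closedBall] at hy
    rw [Metric.mem_ball]
    refine lt_of_le_of_ne hy fun heq => ?_
    by_cases hin : ‖y - x‖ ≤ ρ
    · have h1 := hc y ⟨heq, by simpa [dist_eq_norm] using hin⟩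
      have h2 := hv1 y
      have h3 := hvpos z
      nlinarith
    · push Not at hin
      have h1 := hvz y hin
      have h2 := hmax y
      nlinarith
  have hloc : IsLocalMax (fun y => 1 * ψ y + (-1) * φ y + ε * v y) y := by
    apply hym.isLocalMax
    exact Filter.mem_of_superset (Metric.isOpen_ball.mem_nhds hyball) Metric.ball_subset_closedBall
  have hcc : ContDiff ℝ 2 (fun y => 1 * ψ y + (-1) * φ y + ε * v y) :=
    ((contDiff_const.mul hψ.1).add (contDiff_const.mul hφ.1)).add (contDiff_const.mul hvc)
  obtain ⟨g, lp⟩ := max_test hcc hloc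
  rw [grad_comb hψ.1 hφ.1 hvc] at g
  rw [lap_comb hψ.1 hφ.1 hvc] at lp
  obtain ⟨hv2, hv3⟩ := hv y
  have g' : gradient φ y - gradient ψ y = ε • gradient v y := by
    have : gradient φ y - gradient ψ y = ε • gradient v y -
      ((1:ℝ) • gradient ψ y + (-1:ℝ) • gradient φ y + ε • gradient v y) := by module
    rw [this, g, sub_zero]
  have hdiff : |‖gradient φ y‖ - ‖gradient ψ y‖| ≤ ε * ‖gradient v y‖ := by
    refine (abs_norm_sub_norm_le _ _).trans ?_
    rw [g', norm_smul, Real.norm_of_nonneg hε0.le]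
  have hGy := hG y hy
  have hl := hlip ‖gradient ψ y‖ ‖gradient φ y‖ (norm_nonneg _)
    (by linarith [norm_nonneg (gradient φ y)]) (norm_nonneg _)
    (by linarith [norm_nonneg (gradient ψ y)])
  have hl2 : L * |‖gradient φ y‖ - ‖gradient ψ y‖| ≤ L * (ε * ‖gradient v y‖) := by gcongr
  have e1 := hφ.2 y
  have e2 := hψ.2 y
  have hkey : ε * lap v y ≤ 2 * (L * (ε * ‖gradient v y‖)) := by linarith
  have hkey2 : lap v y ≤ 2 * L * ‖gradient v y‖ := by
    by_contra! hcon
    nlinarith [mul_lt_mul_of_pos_left hcon hε0]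
  rw [hv2, hv3] at hkey2
  have hkey3 : 4 * k ^ 2 * ‖y - x‖ ^ 2 - 2 * m * k ≤ 2 * L * (2 * k * ‖y - x‖) := by
    refine le_of_mul_le_mul_right ?_ (hvpos y)
    linarith
  have hkey4 : 2 * k * ‖y - x‖ ^ 2 ≤ m + 2 * L * ‖y - x‖ := by
    refine le_of_mul_le_mul_left ?_ (show 0 < 2 * k by positivity)
    linarith
  have hyz2 : ‖y - z‖ ≤ ρ / 2 := by simpa [dist_eq_norm] using hy
  have r1 : ρ / 2 ≤ ‖y - x‖ := by
    have : ‖z - x‖ ≤ ‖y - x‖ + ‖y - z‖ := by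
      have e : z - x = (y - x) - (y - z) := by abel
      rw [e]; exact norm_sub_le _ _
    linarith
  have r2 : ‖y - x‖ ≤ 2 * ρ := by
    have : ‖y - x‖ ≤ ‖z - x‖ + ‖y - z‖ := by
      have e : y - x = (z - x) + (y - z) := by abel
      rw [e]; exact norm_add_le _ _
    linarith
  have r3 : 2 * k * (ρ / 2) ^ 2 = m + 4 * L * ρ + 1 := by
    rw [hk]; field_simp; 
  have r4 : 2 * k * (ρ / 2) ^ 2 ≤ 2 * k * ‖y - x‖ ^ 2 := by gcongr
  have r5 : 2 * L * ‖y - x‖ ≤ 2 * L * (2 * ρ) := by gcongr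
  linarith

theorem exists_max {m : ℕ} {γ A B : ℝ} (hγ : 0 < γ) (hB : 0 < B)
    {u : EuclideanSpace ℝ (Fin m) → ℝ} (hu : Continuous u)
    (hb : ∀ y, u y ≤ A - B * ‖y‖ ^ γ) : ∃ y0, ∀ y, u y ≤ u y0 := by
  apply hu.exists_forall_ge
  have h1 : Tendsto (fun y : EuclideanSpace ℝ (Fin m) => ‖y‖ ^ γ)
      (cocompact (EuclideanSpace ℝ (Fin m))) atTop :=
    (tendsto_rpow_atTop hγ).comp tendsto_norm_cocompact_atTop
  have h2 : Tendsto (fun y : EuclideanSpace ℝ (Fin m) => A - B * ‖y‖ ^ γ)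
      (cocompact (EuclideanSpace ℝ (Fin m))) atBot := by
    have := tendsto_atBot_add_const_left _ A (tendsto_neg_atTop_atBot.comp (h1.const_mul_atTop hB))
    exact this.congr (fun y => by simp [sub_eq_add_neg])
  exact tendsto_atBot_mono hb h2

theorem rpow_cmp {α t : ℝ} (hα : 0 < α) (ht : 0 ≤ t) :
    (1 + t ^ 2) ^ (α / 2) ≤ 2 ^ α * (t ^ α + 1) := by
  have h1 : (1 + t ^ 2) ^ (α / 2) ≤ (1 + t) ^ α := by
    have e : (1 + t) ^ α = ((1 + t) ^ 2) ^ (α / 2) := by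
      rw [← Real.rpow_natCast, ← Real.rpow_mul (by positivity)]; congr 1; push_cast; ring
    rw [e]
    apply Real.rpow_le_rpow (by positivity) (by nlinarith) (by positivity)
  refine h1.trans ?_
  have hp : 0 ≤ t ^ α := by positivity
  have h2 : (0:ℝ) < 2 ^ α := by positivity
  rcases le_total t 1 with h | h
  · have : (1 + t) ^ α ≤ 2 ^ α := Real.rpow_le_rpow (by positivity) (by linarith) hα.le
    nlinarith
  · have : (1 + t) ^ α ≤ (2 * t) ^ α := Real.rpow_le_rpow (by positivity) (by linarith) hα.le
    rw [Real.mul_rpow (by norm_num) ht] at this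
    nlinarith

set_option maxHeartbeats 2000000 in
theorem step {m : ℕ} {θ α f₀ : ℝ} (hθ : 1 < θ) (hα : 0 < α) (hf₀ : 0 < f₀)
    {f φ ψ : EuclideanSpace ℝ (Fin m) → ℝ} {l1 l2 : ℝ} (hH1 : H1 f α f₀)
    (hφ : IsSolution θ f l1 φ) (hψ : IsSolution θ f l2 ψ)
    (hΨ : MemPhi (α / θ + 1) ψ) {δb : ℝ} (h1 : δb < 1) :
    ∃ ε' > 0, ∀ δ, 0 < δ → δ ≤ δb → (∃ M, ∀ y, (δ - ε') * ψ y - φ y ≤ M) →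
      ∃ M, ∀ y, δ * ψ y - φ y ≤ M := by
  obtain ⟨-, c, hc1, hc⟩ := hΨ
  set γ := α / θ + 1 with hγ
  have hαθ : 0 < α / θ := by positivity
  have hγ1 : 1 < γ := by linarith
  set d := 1 - δb with hd
  have hd0 : 0 < d := by linarith
  set κ := f₀⁻¹ * (2 ^ α)⁻¹ with hκ
  have hκ0 : 0 < κ := by positivity
  set D := d ^ (1 - θ) with hD
  have hD0 : 0 < D := by positivity
  set ε := min 1 ((θ * d * κ / 2 / D) ^ (θ⁻¹) / γ) with hε
  have hε0 : 0 < ε := by rw [hε]; apply lt_min one_pos; positivity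
  have hε1 : ε ≤ 1 := min_le_left _ _
  have hεb : 1 / θ * (D * (ε * γ) ^ θ) ≤ d * κ / 2 := by
    have h2 : ε * γ ≤ (θ * d * κ / 2 / D) ^ (θ⁻¹) := by
      rw [← le_div_iff₀ (by positivity)]; exact min_le_right _ _
    rw [Real.le_rpow_inv_iff_of_pos (by positivity) (by positivity) (by positivity)] at h2
    rw [le_div_iff₀ hD0] at h2
    rw [one_div, inv_mul_le_iff₀ (by positivity)]
    linarith
  refine ⟨ε / (2 * c), by positivity, ?_⟩
  intro δ hδ0 hδb ⟨M0, hM0⟩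
  have hδ1 : δ < 1 := by linarith
  set C := (|l1| + |l2|) + 1 / 2 * (3 * γ ^ 2 + m * γ) with hC
  have hC0 : 0 ≤ C := by positivity
  set Q := 2 * C / (d * κ) with hQ
  have hQ0 : 0 ≤ Q := by positivity
  set ρ := (Q ^ (θ - 1)⁻¹) ^ (γ - 1)⁻¹ with hρ
  have cφ := hφ.1.continuous
  have cψ := hψ.1.continuous
  obtain ⟨M, hM⟩ : ∃ M, ∀ y ∈ Metric.closedBall (0 : EuclideanSpace ℝ (Fin m)) ρ,
      δ * ψ y - φ y ≤ M := by
    obtain ⟨G, hG⟩ := (isCompact_closedBall (0 : EuclideanSpace ℝ (Fin m)) ρ).bddAbove_image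
      (f := fun y => δ * ψ y - φ y) (by fun_prop)
    exact ⟨G, fun y hy => hG ⟨y, hy, rfl⟩⟩
  refine ⟨M, ?_⟩
  have main : ∀ R > 0, ∀ y : EuclideanSpace ℝ (Fin m), δ * ψ y - φ y
      - ε * (((1 + ‖y‖ ^ 2) ^ (γ / 2)) ^ 2 / ((1 + ‖y‖ ^ 2) ^ (γ / 2) + R)) ≤ M := by
    intro R hR
    obtain ⟨χ, hχ⟩ : ∃ χ : EuclideanSpace ℝ (Fin m) → ℝ, χ = fun y =>
      ε * (((1 + ‖y‖ ^ 2) ^ (γ / 2)) ^ 2 / ((1 + ‖y‖ ^ 2) ^ (γ / 2) + R)) := ⟨_, rfl⟩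
    obtain ⟨hχc, hχb⟩ := pen hγ1 hε0 hε1 hR χ hχ
    have cχ := hχc.continuous
    have hgrow : ∀ y, δ * ψ y + (-1) * φ y + (-1) * χ y
        ≤ (M0 + ε * R + ε / 2) - (ε / 2) * ‖y‖ ^ γ := by
      intro y
      have hs1 : ‖y‖ ^ γ ≤ (1 + ‖y‖ ^ 2) ^ (γ / 2) := by
        have e : ‖y‖ ^ γ = (‖y‖ ^ 2) ^ (γ / 2) := by
          rw [← Real.rpow_natCast, ← Real.rpow_mul (by positivity)]; congr 1; push_cast; ring
        rw [e]
        apply Real.rpow_le_rpow (by positivity) (by linarith) (by positivity)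
      have hχy : χ y = ε * (((1 + ‖y‖ ^ 2) ^ (γ / 2)) ^ 2 / ((1 + ‖y‖ ^ 2) ^ (γ / 2) + R)) := by
        rw [hχ]
      have hsp : 0 < (1 + ‖y‖ ^ 2) ^ (γ / 2) := by positivity
      generalize (1 + ‖y‖ ^ 2) ^ (γ / 2) = s at *
      have h2 : s - R ≤ s ^ 2 / (s + R) := by
        rw [le_div_iff₀ (by positivity)]; nlinarith
      have h3 : ε * (s - R) ≤ χ y := by rw [hχy]; gcongr
      have h4 : ε / (2 * c) * ψ y ≤ ε / 2 * (1 + ‖y‖ ^ γ) := by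
        have := mul_le_mul_of_nonneg_left (hc y).2 (show 0 ≤ ε / (2 * c) by positivity)
        refine this.trans (le_of_eq ?_)
        field_simp
      have h5 := hM0 y
      have h6 : ε * ‖y‖ ^ γ ≤ ε * s := by gcongr
      nlinarith
    obtain ⟨y0, hy0⟩ := exists_max (by linarith) (by positivity) (by fun_prop) hgrow
    have hloc : IsLocalMax (fun y => δ * ψ y + (-1) * φ y + (-1) * χ y) y0 :=
      Filter.Eventually.of_forall hy0
    have hin := max_ineq hθ hδ0 hδ1 hφ hψ hχc hloc
    obtain ⟨hg, hl⟩ := hχb y0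
    have hball : y0 ∈ Metric.closedBall (0 : EuclideanSpace ℝ (Fin m)) ρ := by
      rw [mem_closedBall_zero_iff]
      set X := (1 + ‖y0‖ ^ 2) ^ ((γ - 1) / 2) with hX
      have hX1 : 1 ≤ X := Real.one_le_rpow (by nlinarith [norm_nonneg y0]) (by linarith)
      have hyX : ‖y0‖ ^ (γ - 1) ≤ X := by
        have e : ‖y0‖ ^ (γ - 1) = (‖y0‖ ^ 2) ^ ((γ - 1) / 2) := by
          rw [← Real.rpow_natCast, ← Real.rpow_mul (by positivity)]; congr 1; push_cast; ring
        rw [e]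
        apply Real.rpow_le_rpow (by positivity) (by linarith) (by linarith)
      have hXθ : X ^ θ = (1 + ‖y0‖ ^ 2) ^ (α / 2) := by
        rw [hX, ← Real.rpow_mul (by positivity)]; congr 1; rw [hγ]; field_simp; ring
      have hfX : κ * X ^ θ ≤ f y0 := by
        refine le_trans ?_ (hH1 y0).1
        rw [hXθ, hκ, mul_assoc]
        apply mul_le_mul_of_nonneg_left _ (by positivity)
        rw [inv_mul_le_iff₀ (by positivity)]
        exact rpow_cmp hα (norm_nonneg _)
      have hXp : 0 < X ^ θ := by positivity
      have hD' : (1 - δ) ^ (1 - θ) ≤ D :=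
        Real.rpow_le_rpow_of_nonpos hd0 (by linarith) (by linarith)
      have t1 : 1 / θ * ((1 - δ) ^ (1 - θ) * ‖gradient χ y0‖ ^ θ) ≤ d * κ / 2 * X ^ θ := by
        have a1 : ‖gradient χ y0‖ ^ θ ≤ (ε * γ) ^ θ * X ^ θ := by
          rw [← Real.mul_rpow (by positivity) (by positivity)]
          exact Real.rpow_le_rpow (norm_nonneg _) hg (by linarith)
        calc _ ≤ 1 / θ * (D * ((ε * γ) ^ θ * X ^ θ)) := by gcongr
          _ = (1 / θ * (D * (ε * γ) ^ θ)) * X ^ θ := by ring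
          _ ≤ _ := by gcongr
      have t2 : d * (κ * X ^ θ) ≤ (1 - δ) * f y0 := by
        apply mul_le_mul (by linarith) hfX (by positivity) (by linarith)
      have t3 : l1 - δ * l2 ≤ (|l1| + |l2|) * X := by
        have a1 := le_abs_self l1
        have a2 : -(δ * l2) ≤ |l2| := by
          have := neg_abs_le l2
          nlinarith [abs_nonneg l2]
        have a3 : 0 ≤ |l1| + |l2| := by positivity
        nlinarith
      have t4 : d * κ / 2 * X ^ θ ≤ C * X := by
        rw [hC]; linarith
      have t5 : X ^ (θ - 1) ≤ Q := by
        rw [Real.rpow_sub_one (by positivity), div_le_iff₀ (by positivity), hQ]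
        rw [div_mul_eq_mul_div, le_div_iff₀ (by positivity)]
        linarith
      have t6 : X ≤ Q ^ (θ - 1)⁻¹ := by
        rw [Real.le_rpow_inv_iff_of_pos (by positivity) hQ0 (by linarith)]; exact t5
      rw [hρ, Real.le_rpow_inv_iff_of_pos (norm_nonneg _) (by positivity) (by linarith)]
      exact hyX.trans t6
    intro y
    have h2 := hM y0 hball
    have h3 := hy0 y
    have h4 : 0 ≤ χ y0 := by rw [hχ]; positivity
    have h5 : χ y = ε * (((1 + ‖y‖ ^ 2) ^ (γ / 2)) ^ 2 / ((1 + ‖y‖ ^ 2) ^ (γ / 2) + R)) := by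
      rw [hχ]
    rw [← h5]
    linarith
  intro y
  apply le_of_forall_pos_le_add
  intro η hη
  have hsp : 0 < (1 + ‖y‖ ^ 2) ^ (γ / 2) := by positivity
  have h2 := main (((1 + ‖y‖ ^ 2) ^ (γ / 2)) ^ 2 / η) (by positivity) y
  generalize (1 + ‖y‖ ^ 2) ^ (γ / 2) = s at *
  have h3 : s ^ 2 / (s + s ^ 2 / η) ≤ η := by
    rw [div_le_iff₀ (by positivity), mul_add, mul_div_cancel₀ _ hη.ne']
    nlinarith
  have h4 : 0 ≤ s ^ 2 / (s + s ^ 2 / η) := by positivity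
  nlinarith

theorem bounded_all {m : ℕ} {θ α f₀ : ℝ} (hθ : 1 < θ) (hα : 0 < α) (hf₀ : 0 < f₀)
    {f φ ψ : EuclideanSpace ℝ (Fin m) → ℝ} {l1 l2 : ℝ} (hH1 : H1 f α f₀)
    (hφ : IsSolution θ f l1 φ) (hψ : IsSolution θ f l2 ψ)
    (hΦ : MemPhi (α / θ + 1) φ) (hΨ : MemPhi (α / θ + 1) ψ) {δ : ℝ} (h0 : 0 < δ) (h1 : δ < 1) :
    ∃ M, ∀ y, δ * ψ y - φ y ≤ M := by
  obtain ⟨ε', hε', hstep⟩ := step hθ hα hf₀ hH1 hφ hψ hΨ h1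
  obtain ⟨-, c, hc1, hc⟩ := hΨ
  obtain ⟨-, c', hc1', hc'⟩ := hΦ
  have hlow : ∀ y, -c ≤ ψ y := fun y => by
    have : 0 ≤ c⁻¹ * ‖y‖ ^ (α / θ + 1) := by positivity
    linarith [(hc y).1]
  have hlow' : ∀ y, -c' ≤ φ y := fun y => by
    have : 0 ≤ c'⁻¹ * ‖y‖ ^ (α / θ + 1) := by positivity
    linarith [(hc' y).1]
  have ind : ∀ n : ℕ, ∀ a, 0 < a → a ≤ δ → a ≤ n * ε' → ∃ M, ∀ y, a * ψ y - φ y ≤ M := by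
    intro n
    induction n with
    | zero => intro a ha _ h; simp at h; linarith
    | succ n ih =>
      intro a ha haδ h
      apply hstep a ha haδ
      by_cases hn : 0 < a - ε'
      · apply ih _ hn (by linarith)
        push_cast at h
        linarith
      · refine ⟨(ε' - a) * c + c', fun y => ?_⟩
        push Not at hn
        have := hlow y
        have := hlow' y
        nlinarith
  obtain ⟨n, hn⟩ := exists_nat_ge (δ / ε')
  exact ind n δ h0 le_rfl (by rwa [div_le_iff₀ hε'] at hn)

theorem max_exists {m : ℕ} {θ α f₀ : ℝ} (hθ : 1 < θ) (hα : 0 < α) (hf₀ : 0 < f₀)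
    {f φ ψ : EuclideanSpace ℝ (Fin m) → ℝ} {l1 l2 : ℝ} (hH1 : H1 f α f₀)
    (hφ : IsSolution θ f l1 φ) (hψ : IsSolution θ f l2 ψ)
    (hΦ : MemPhi (α / θ + 1) φ) (hΨ : MemPhi (α / θ + 1) ψ) {δ : ℝ} (h0 : 0 < δ) (h1 : δ < 1) :
    ∃ y0, (∀ y, δ * ψ y - φ y ≤ δ * ψ y0 - φ y0) ∧ (1 - δ) * f y0 ≤ l1 - δ * l2 := by
  obtain ⟨M, hM⟩ := bounded_all hθ hα hf₀ hH1 hφ hψ hΦ hΨ (δ := (1 + δ) / 2)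
    (by linarith) (by linarith)
  obtain ⟨-, c, hc1, hc⟩ := hΨ
  have cφ := hφ.1.continuous
  have cψ := hψ.1.continuous
  obtain ⟨y0, hy0⟩ := exists_max (γ := α / θ + 1) (A := M + (1 - δ) / 2 * c)
    (B := (1 - δ) / 2 * c⁻¹) (u := fun y => δ * ψ y - φ y) (by positivity)
    (mul_pos (by linarith) (by positivity)) (by fun_prop) (fun y => by
      have h2 := mul_le_mul_of_nonneg_left (hc y).1 (show 0 ≤ (1 - δ) / 2 by linarith)
      have h3 := hM y
      linarith)
  refine ⟨y0, hy0, ?_⟩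
  have h := max_ineq (χ := fun _ => (0:ℝ)) (y := y0) hθ h0 h1 hφ hψ contDiff_const
    (Filter.Eventually.of_forall fun y => by have := hy0 y; simp only at this ⊢; linarith)
  have e1 : gradient (fun _ : EuclideanSpace ℝ (Fin m) => (0:ℝ)) y0 = 0 := by
    simp [gradient]
  have e2 : lap (fun _ : EuclideanSpace ℝ (Fin m) => (0:ℝ)) y0 = 0 := by
    rw [lap_eq]
    have : fderiv ℝ (fun _ : EuclideanSpace ℝ (Fin m) => (0:ℝ)) = fun _ => 0 := by
      funext y; simp
    rw [this]; simp
  rw [e1, e2, norm_zero, Real.zero_rpow (by linarith)] at h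
  linarith

theorem lam_le {m : ℕ} {θ α f₀ : ℝ} (hθ : 1 < θ) (hα : 0 < α) (hf₀ : 0 < f₀)
    {f φ ψ : EuclideanSpace ℝ (Fin m) → ℝ} {l1 l2 : ℝ} (hH1 : H1 f α f₀)
    (hφ : IsSolution θ f l1 φ) (hψ : IsSolution θ f l2 ψ)
    (hΦ : MemPhi (α / θ + 1) φ) (hΨ : MemPhi (α / θ + 1) ψ) : l2 ≤ l1 := by
  have key : ∀ δ, 0 < δ → δ < 1 → 0 ≤ l1 - δ * l2 := by
    intro δ h0 h1
    obtain ⟨y0, -, h⟩ := max_exists hθ hα hf₀ hH1 hφ hψ hΦ hΨ h0 h1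
    have h2 : 0 ≤ f y0 := le_trans (by positivity) (hH1 y0).1
    have : 0 ≤ (1 - δ) * f y0 := mul_nonneg (by linarith) h2
    linarith
  by_contra! hlt
  have hp := key (1 / 2) (by norm_num) (by norm_num)
  have h3 := key (1 - (l2 - l1) / (2 * (|l2| + |l1| + 1))) (by
      have : (l2 - l1) / (2 * (|l2| + |l1| + 1)) < 1 := by
        rw [div_lt_one (by positivity)]
        linarith [le_abs_self l2, neg_abs_le l1, abs_nonneg l2, abs_nonneg l1]
      linarith) (by
      have : 0 < (l2 - l1) / (2 * (|l2| + |l1| + 1)) := div_pos (by linarith) (by positivity)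
      linarith)
  have h4 : (l2 - l1) / (2 * (|l2| + |l1| + 1)) * l2 ≤ (l2 - l1) / 2 := by
    rw [div_mul_eq_mul_div, div_le_div_iff₀ (by positivity) (by norm_num)]
    nlinarith [le_abs_self l2, abs_nonneg l1]
  nlinarith

theorem stmt16 (m : ℕ) (hm : 1 ≤ m) (θ : ℝ) (hθ1 : 1 < θ) (hθ2 : θ < 2)
    (α f₀ : ℝ) (hα : 0 < α) (hf₀ : 0 < f₀)
    (f : EuclideanSpace ℝ (Fin m) → ℝ) (hH0 : H0 f α f₀) (hH1 : H1 f α f₀)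
    (lam₁ lam₂ : ℝ) (φ ψ : EuclideanSpace ℝ (Fin m) → ℝ)
    (h₁ : IsSolution θ f lam₁ φ) (h₂ : IsSolution θ f lam₂ ψ)
    (hΦφ : MemPhi (α / θ + 1) φ) (hΦψ : MemPhi (α / θ + 1) ψ) :
    lam₁ = lam₂ ∧ ∃ C : ℝ, ∀ y, φ y = ψ y + C := by
  have hl : lam₁ = lam₂ := le_antisymm (lam_le hθ1 hα hf₀ hH1 h₂ h₁ hΦψ hΦφ)
    (lam_le hθ1 hα hf₀ hH1 h₁ h₂ hΦφ hΦψ)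
  refine ⟨hl, ?_⟩
  subst hl
  set ρ := (f₀ * |lam₁|) ^ α⁻¹ with hρ
  have hρ0 : 0 ≤ ρ := by positivity
  have cφ := h₁.1.continuous
  have cψ := h₂.1.continuous
  obtain ⟨y0, -, hy0⟩ := (isCompact_closedBall (0 : EuclideanSpace ℝ (Fin m)) ρ).exists_isMaxOn
    ⟨0, by simpa using hρ0⟩ (f := fun y => ψ y - φ y) (by fun_prop)
  have hmax : ∀ y, ψ y - φ y ≤ ψ y0 - φ y0 := by
    intro y
    have key : ∀ δ, 0 < δ → δ < 1 →
        δ * ψ y - φ y ≤ ψ y0 - φ y0 + (1 - δ) * hΦψ.2.choose := by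
      intro δ hδ0 hδ1
      obtain ⟨z, hz1, hz2⟩ := max_exists hθ1 hα hf₀ hH1 h₁ h₂ hΦφ hΦψ hδ0 hδ1
      have hfz : f z ≤ lam₁ := by
        refine le_of_mul_le_mul_left ?_ (show 0 < 1 - δ by linarith)
        linarith
      have hzb : z ∈ Metric.closedBall (0 : EuclideanSpace ℝ (Fin m)) ρ := by
        rw [mem_closedBall_zero_iff, hρ,
          Real.le_rpow_inv_iff_of_pos (norm_nonneg _) (by positivity) hα]
        have h3 := (hH1 z).1
        rw [inv_mul_le_iff₀ hf₀] at h3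
        have h4 : f₀ * f z ≤ f₀ * |lam₁| := by
          gcongr; exact hfz.trans (le_abs_self _)
        linarith
      have h5 : ψ z - φ z ≤ ψ y0 - φ y0 := hy0 hzb
      obtain ⟨hc1, hc⟩ := hΦψ.2.choose_spec
      have h6 : -hΦψ.2.choose ≤ ψ z := by
        have := (hc z).1
        have h7 : 0 ≤ (hΦψ.2.choose)⁻¹ * ‖z‖ ^ (α / θ + 1) := by positivity
        linarith
      have h8 := hz1 y
      nlinarith
    generalize hΦψ.2.choose = c at key
    have hlim : Tendsto (fun δ : ℝ => ψ y0 - φ y0 + (1 - δ) * c - (δ * ψ y - φ y))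
        (nhdsWithin 1 (Set.Iio 1)) (nhds (ψ y0 - φ y0 + (1 - 1) * c - (1 * ψ y - φ y))) := by
      apply Filter.Tendsto.mono_left _ nhdsWithin_le_nhds
      apply Continuous.tendsto
      fun_prop
    have := ge_of_tendsto hlim (b := 0) (by
      filter_upwards [Ioo_mem_nhdsLT (show (0:ℝ) < 1 by norm_num)] with δ hδ
      linarith [key δ hδ.1 hδ.2])
    linarith
  have h := smp hθ1 h₁ h₂ y0 hmax
  refine ⟨-(ψ y0 - φ y0), fun y => ?_⟩
  linarith [h y]
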